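/- arXiv:1406.7279 — 8 statements merged into one kernel-verified Lean document; each statement's English description precedes it below -/
import Mathlib

section
/- Let x_1, …, x_n be vectors in a real inner product space satisfying the ℓ₂² triangle inequalities. Then for all indices i, j, k, l ∈ [n] with x_k ≠ x_l, one has ⟨x_i − x_j, (x_k − x_l)/‖x_k − x_l‖⟩² ≤ |⟨x_i − x_j, x_k − x_l⟩| ≤ ‖x_i − x_j‖². -/
open RealInnerProductSpace

theorem two_mul_inner_sub_sub_eq {E : Type*} [NormedAddCommGroup E] [InnerProductSpace ℝ E]
    (a b c d : E) :
    2 * ⟪a - b, c - d⟫ = ‖a - d‖ ^ 2 + ‖b - c‖ ^ 2 - ‖a - c‖ ^ 2 - ‖b - d‖ ^ 2 := by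
  simp only [norm_sub_sq_real, inner_sub_left, inner_sub_right]
  ring

theorem abs_inner_sub_sub_le_norm_sq {ι E : Type*} [NormedAddCommGroup E]
    [InnerProductSpace ℝ E] (x : ι → E)
    (htri : ∀ i j k : ι, ‖x i - x k‖ ^ 2 ≤ ‖x i - x j‖ ^ 2 + ‖x j - x k‖ ^ 2)
    (i j k l : ι) : |⟪x i - x j, x k - x l⟫| ≤ ‖x i - x j‖ ^ 2 := by
  have h := two_mul_inner_sub_sub_eq (x i) (x j) (x k) (x l)
  have hil := htri i j l
  have hik := htri i j k
  have hjk := htri j i k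
  have hjl := htri j i l
  rw [norm_sub_rev (x j) (x i)] at hjk hjl
  rw [abs_le]
  constructor <;> linarith

/-- Proposition 1 (ℓ₂² projection property): if `x 1, …, x n` satisfy the ℓ₂² triangle
inequalities, then for all `i j k l` with `x k ≠ x l`,
`⟪x i − x j, (x k − x l)/‖x k − x l‖⟫² ≤ |⟪x i − x j, x k − x l⟫| ≤ ‖x i − x j‖²`. -/
theorem stmt_0 {E : Type*} [NormedAddCommGroup E] [InnerProductSpace ℝ E]
    {n : ℕ} (x : Fin n → E)
    (htri : ∀ i j k : Fin n, ‖x i - x k‖ ^ 2 ≤ ‖x i - x j‖ ^ 2 + ‖x j - x k‖ ^ 2)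
    (i j k l : Fin n) (hkl : x k ≠ x l) :
    ⟪x i - x j, ‖x k - x l‖⁻¹ • (x k - x l)⟫ ^ 2 ≤ |⟪x i - x j, x k - x l⟫| ∧
      |⟪x i - x j, x k - x l⟫| ≤ ‖x i - x j‖ ^ 2 := by
  refine ⟨?_, abs_inner_sub_sub_le_norm_sq x htri i j k l⟩
  have h := abs_inner_sub_sub_le_norm_sq x htri k l i j
  rw [real_inner_comm] at h
  have hpos : 0 < ‖x k - x l‖ ^ 2 := by
    have := norm_pos_iff.mpr (sub_ne_zero.mpr hkl)
    positivity
  rw [real_inner_smul_right, mul_pow, inv_pow, inv_mul_le_iff₀ hpos, ← sq_abs, sq]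
  exact mul_le_mul_of_nonneg_right h (abs_nonneg _)
end

section
/- Let x_1, …, x_n be vectors in a real inner product space satisfying the ℓ₂² triangle inequalities. Then for all indices i, j, k, l ∈ [n], one has |⟨x_k − x_l, x_i − x_j⟩| ≤ ‖x_i − x_j‖², and likewise |⟨x_k − x_l, x_i − x_j⟩| ≤ ‖x_k − x_l‖². -/
open RealInnerProductSpace

/-- The triangle inequality for squared distances says that the angle at `b` is not obtuse. -/
theorem inner_sub_sub_nonneg_of_sq_triangle {E : Type*} [NormedAddCommGroup E]
    [InnerProductSpace ℝ E] {a b c : E} (h : ‖a - c‖ ^ 2 ≤ ‖a - b‖ ^ 2 + ‖b - c‖ ^ 2) :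
    0 ≤ ⟪a - b, c - b⟫ := by
  have key := norm_sub_sq_real (a - b) (c - b)
  rw [sub_sub_sub_cancel_right, norm_sub_rev c b] at key
  linarith

/-- If the points `c` and `d` see `a` and `b` under non-obtuse angles at `a` and at `b`, then
`c - d` has inner product at most `‖a - b‖ ^ 2` with `a - b`. -/
theorem abs_inner_sub_sub_le_of_acute {E : Type*} [NormedAddCommGroup E]
    [InnerProductSpace ℝ E] {a b c d : E}
    (hcb : 0 ≤ ⟪c - b, a - b⟫) (hca : 0 ≤ ⟪c - a, b - a⟫)
    (hdb : 0 ≤ ⟪d - b, a - b⟫) (hda : 0 ≤ ⟪d - a, b - a⟫) :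
    |⟪c - d, a - b⟫| ≤ ‖a - b‖ ^ 2 := by
  have split (p : E) : ‖a - b‖ ^ 2 = ⟪p - b, a - b⟫ + ⟪p - a, b - a⟫ := by
    rw [← neg_sub a b, inner_neg_right, ← sub_eq_add_neg, ← inner_sub_left,
      sub_sub_sub_cancel_left, real_inner_self_eq_norm_sq]
  have diff : ⟪c - d, a - b⟫ = ⟪c - b, a - b⟫ - ⟪d - b, a - b⟫ := by
    rw [← inner_sub_left, sub_sub_sub_cancel_right]
  rw [abs_le]
  constructor <;> linarith [split c, split d]

/-- If `x 1, …, x n` satisfy the ℓ₂² triangle inequalities, then for all `i j k l`,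
`|⟪x k − x l, x i − x j⟫| ≤ ‖x i − x j‖²` and `|⟪x k − x l, x i − x j⟫| ≤ ‖x k − x l‖²`. -/
theorem stmt_1 {E : Type*} [NormedAddCommGroup E] [InnerProductSpace ℝ E]
    {n : ℕ} (x : Fin n → E)
    (htri : ∀ i j k : Fin n, ‖x i - x k‖ ^ 2 ≤ ‖x i - x j‖ ^ 2 + ‖x j - x k‖ ^ 2)
    (i j k l : Fin n) :
    |⟪x k - x l, x i - x j⟫| ≤ ‖x i - x j‖ ^ 2 ∧
      |⟪x k - x l, x i - x j⟫| ≤ ‖x k - x l‖ ^ 2 := by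
  have acute (p q r : Fin n) : 0 ≤ ⟪x p - x q, x r - x q⟫ :=
    inner_sub_sub_nonneg_of_sq_triangle (htri p q r)
  have bound (a b c d : Fin n) : |⟪x c - x d, x a - x b⟫| ≤ ‖x a - x b‖ ^ 2 :=
    abs_inner_sub_sub_le_of_acute (acute c b a) (acute c a b) (acute d b a) (acute d a b)
  refine ⟨bound i j k l, ?_⟩
  rw [real_inner_comm]
  exact bound k l i j
end

section
/- Let x_1, …, x_n be vectors in Euclidean space ℝ^d, not all equal (so that Σ_{p<q} ‖x_p − x_q‖² > 0). Let λ_1 ≥ λ_2 ≥ … ≥ λ_N ≥ 0 be the eigenvalues, arranged in descending order, of the Gram matrix of the family {x_i − x_j}_{1 ≤ i < j ≤ n} (here N = n(n−1)/2). Suppose that for some r ∈ [N] and δ > 0 one has Σ_{t=1}^{r} λ_t ≥ δ · Σ_{t=1}^{N} λ_t. Then there exist indices k < l with x_k ≠ x_l such that Σ_{i<j} ⟨x_i − x_j, (x_k − x_l)/‖x_k − x_l‖⟩² ≥ (δ²/r) · Σ_{i<j} ‖x_i − x_j‖². -/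
open RealInnerProductSpace Finset

/-- The index type of unordered pairs `{(i, j) : i < j}` from `[n]`. -/
abbrev Pairs (n : ℕ) : Type := {p : Fin n × Fin n // p.1 < p.2}

/-- The squared entries of a real symmetric matrix sum to the sum of its squared eigenvalues. -/
lemma Matrix.IsHermitian.sum_sq_entries_eq_sum_sq_eigenvalues {ι : Type*} [Fintype ι]
    [DecidableEq ι] {A : Matrix ι ι ℝ} (hA : A.IsHermitian) :
    ∑ p, ∑ q, A p q ^ 2 = ∑ t, hA.eigenvalues t ^ 2 := by
  have hentries : ∑ p, ∑ q, A p q ^ 2 = (A * A).trace := by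
    simp only [Matrix.trace, Matrix.diag_apply, Matrix.mul_apply]
    refine sum_congr rfl fun p _ => sum_congr rfl fun q _ => ?_
    have h := hA.apply p q
    rw [star_trivial] at h
    rw [h, sq]
  have hsq : A * A = Unitary.conjStarAlgAut ℝ _ hA.eigenvectorUnitary
      (Matrix.diagonal hA.eigenvalues * Matrix.diagonal hA.eigenvalues) := by
    rw [map_mul]
    have h := hA.spectral_theorem
    exact congrArg₂ (· * ·) h h
  rw [hentries, hsq, Unitary.conjStarAlgAut_apply, Matrix.trace_mul_comm, ← mul_assoc,
    Unitary.coe_star_mul_self, one_mul, Matrix.diagonal_mul_diagonal, Matrix.trace_diagonal]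
  exact sum_congr rfl fun t _ => (sq _).symm

/-- Proposition 3 (existence of a good direction): if the Gram matrix of the family
`{x i − x j}_{i<j}` has at least a `δ` fraction of its spectrum in its top `r` eigenvalues,
then there is a pair `k < l` with `x k ≠ x l` such that
`∑_{i<j} ⟪x i − x j, (x k − x l)/‖x k − x l‖⟫² ≥ (δ²/r) ∑_{i<j} ‖x i − x j‖²`. -/
theorem stmt_3 {d n N : ℕ} (x : Fin n → EuclideanSpace ℝ (Fin d))
    (hpos : 0 < ∑ p : Pairs n, ‖x p.1.1 - x p.1.2‖ ^ 2)
    (G : Matrix (Pairs n) (Pairs n) ℝ)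
    (hGdef : ∀ p q : Pairs n, G p q = ⟪x p.1.1 - x p.1.2, x q.1.1 - x q.1.2⟫)
    (hG : G.IsHermitian)
    (lam : Fin N → ℝ) (e : Fin N ≃ Pairs n)
    (hlam : ∀ t, lam t = hG.eigenvalues (e t))
    (hdesc : Antitone lam)
    (r : ℕ) (hr : 1 ≤ r) (hrN : r ≤ N) (δ : ℝ) (hδ : 0 < δ)
    (hspec : δ * ∑ t, lam t ≤ ∑ t ∈ univ.filter (fun t : Fin N => (t : ℕ) < r), lam t) :
    ∃ k l : Fin n, k < l ∧ x k ≠ x l ∧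
      (δ ^ 2 / (r : ℝ)) * ∑ p : Pairs n, ‖x p.1.1 - x p.1.2‖ ^ 2 ≤
        ∑ p : Pairs n, ⟪x p.1.1 - x p.1.2, ‖x k - x l‖⁻¹ • (x k - x l)⟫ ^ 2 := by
  have hr0 : (0 : ℝ) < r := by exact_mod_cast hr
  have hlamsum : ∑ t, lam t = ∑ p : Pairs n, ‖x p.1.1 - x p.1.2‖ ^ 2 := by
    have htrace := hG.trace_eq_sum_eigenvalues
    simp only [Matrix.trace, Matrix.diag_apply, hGdef, real_inner_self_eq_norm_sq,
      RCLike.ofReal_real_eq_id, id_eq] at htrace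
    simp only [hlam]
    rw [Equiv.sum_comp e hG.eigenvalues, ← htrace]
  have hlamsq : ∑ t, lam t ^ 2 = ∑ p, ∑ q, G p q ^ 2 := by
    simp only [hlam]
    rw [Equiv.sum_comp e fun p => hG.eigenvalues p ^ 2,
      hG.sum_sq_entries_eq_sum_sq_eigenvalues]
  rw [hlamsum] at hspec
  set T := ∑ p : Pairs n, ‖x p.1.1 - x p.1.2‖ ^ 2 with hT
  have hcard : (univ.filter fun t : Fin N => (t : ℕ) < r).card = r := by
    rw [Fin.card_filter_val_lt, min_eq_right hrN]
  have hlower : δ ^ 2 / r * T * T ≤ ∑ p, ∑ q, G p q ^ 2 := by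
    have hcs := sq_sum_le_card_mul_sum_sq
      (s := univ.filter fun t : Fin N => (t : ℕ) < r) (f := lam)
    rw [hcard] at hcs
    have hsub : ∑ t ∈ univ.filter (fun t : Fin N => (t : ℕ) < r), lam t ^ 2 ≤ ∑ t, lam t ^ 2 :=
      sum_le_sum_of_subset_of_nonneg (filter_subset _ _) fun _ _ _ => sq_nonneg _
    have hpow : (δ * T) ^ 2 ≤ r * ∑ t, lam t ^ 2 :=
      (pow_le_pow_left₀ (by positivity) hspec 2).trans
        (hcs.trans (mul_le_mul_of_nonneg_left hsub hr0.le))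
    rw [← hlamsq, show δ ^ 2 / r * T * T = (δ * T) ^ 2 / r by ring, div_le_iff₀' hr0]
    exact hpow
  by_contra! hcon
  have hrow : ∀ q : Pairs n, x q.1.1 ≠ x q.1.2 →
      ∑ p, G p q ^ 2 < δ ^ 2 / r * T * ‖x q.1.1 - x q.1.2‖ ^ 2 := by
    intro q hq
    have hnorm : 0 < ‖x q.1.1 - x q.1.2‖ := norm_pos_iff.mpr (sub_ne_zero.mpr hq)
    have h := hcon q.1.1 q.1.2 q.2 hq
    simp only [real_inner_smul_right, mul_pow, ← mul_sum, ← hGdef, inv_pow] at h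
    rwa [inv_mul_lt_iff₀' (by positivity)] at h
  obtain ⟨q₀, -, hq₀⟩ := exists_lt_of_sum_lt (s := univ) (f := fun _ : Pairs n => (0 : ℝ))
    (by simpa using hpos)
  have hupper : ∑ q, ∑ p, G p q ^ 2 < ∑ q : Pairs n, δ ^ 2 / r * T * ‖x q.1.1 - x q.1.2‖ ^ 2 := by
    refine sum_lt_sum (fun q _ => ?_) ⟨q₀, mem_univ _, hrow q₀ fun h => ?_⟩
    · by_cases hq : x q.1.1 = x q.1.2
      · simp [hGdef, hq]
      · exact (hrow q hq).le
    · simp [h] at hq₀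
  rw [← mul_sum, ← hT, sum_comm] at hupper
  exact hupper.not_ge hlower
end

section
/- Let x_1, …, x_n be vectors in a real inner product space satisfying the ℓ₂² triangle inequalities, and let d_{kl} ≥ 0 for 1 ≤ k < l ≤ n be demand weights with D = Σ_{k<l} d_{kl} ‖x_k − x_l‖² > 0. Define the ℓ₁ embedding y_i ∈ ℝ^{N} (N = n(n−1)/2, coordinates indexed by pairs k < l) by y_i(k, l) = d_{kl} ‖x_k − x_l‖² ⟨x_i − x_l, x_k − x_l⟩ / D. Then for all i, j ∈ [n]: (Σ_{k<l} d_{kl} ⟨x_i − x_j, x_k − x_l⟩²) / D ≤ ‖y_i − y_j‖₁ ≤ ‖x_i − x_j‖², where ‖·‖₁ denotes the ℓ₁ norm Σ_{k<l} |y_i(k,l) − y_j(k,l)|. -/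
open RealInnerProductSpace

/-- Under the `ℓ₂²` triangle inequalities, inner products of differences are bounded by the
squared norm of either difference. -/
theorem abs_inner_sub_sub_le_norm_sub_sq {ι E : Type*} [NormedAddCommGroup E]
    [InnerProductSpace ℝ E] (x : ι → E)
    (htri : ∀ i j k : ι, ‖x i - x k‖ ^ 2 ≤ ‖x i - x j‖ ^ 2 + ‖x j - x k‖ ^ 2)
    (a b c d : ι) :
    |⟪x a - x b, x c - x d⟫| ≤ ‖x a - x b‖ ^ 2 := by
  have hpol : 2 * ⟪x a - x b, x c - x d⟫ =
      ‖x a - x d‖ ^ 2 + ‖x b - x c‖ ^ 2 - ‖x a - x c‖ ^ 2 - ‖x b - x d‖ ^ 2 := by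
    simp only [norm_sub_sq_real, inner_sub_left, inner_sub_right]
    ring
  have hsymm : ‖x b - x a‖ = ‖x a - x b‖ := norm_sub_rev _ _
  have hba := htri b a c
  have hba' := htri b a d
  rw [hsymm] at hba hba'
  have hab := htri a b c
  have hab' := htri a b d
  rw [abs_le]
  constructor <;> linarith

/-- Proposition 5 (distortion of the ℓ₁ embedding): with
`y i (k,l) = d_{kl} ‖x k − x l‖² ⟪x i − x l, x k − x l⟫ / D`, one has
`(∑_{k<l} d_{kl} ⟪x i − x j, x k − x l⟫²) / D ≤ ‖y i − y j‖₁ ≤ ‖x i − x j‖²`. -/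
theorem stmt_6 {E : Type*} [NormedAddCommGroup E] [InnerProductSpace ℝ E]
    {n : ℕ} (x : Fin n → E)
    (htri : ∀ i j k : Fin n, ‖x i - x k‖ ^ 2 ≤ ‖x i - x j‖ ^ 2 + ‖x j - x k‖ ^ 2)
    (dem : Fin n → Fin n → ℝ) (hdem : ∀ k l : Fin n, k < l → 0 ≤ dem k l)
    (D : ℝ) (hD : D = ∑ p : Pairs n, dem p.1.1 p.1.2 * ‖x p.1.1 - x p.1.2‖ ^ 2)
    (hDpos : 0 < D)
    (y : Fin n → Pairs n → ℝ)
    (hy : ∀ (i : Fin n) (p : Pairs n),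
      y i p = dem p.1.1 p.1.2 * ‖x p.1.1 - x p.1.2‖ ^ 2 * ⟪x i - x p.1.2, x p.1.1 - x p.1.2⟫ / D)
    (i j : Fin n) :
    (∑ p : Pairs n, dem p.1.1 p.1.2 * ⟪x i - x j, x p.1.1 - x p.1.2⟫ ^ 2) / D ≤
        ∑ p : Pairs n, |y i p - y j p| ∧
      ∑ p : Pairs n, |y i p - y j p| ≤ ‖x i - x j‖ ^ 2 := by
  have habs (p : Pairs n) : |y i p - y j p| =
      dem p.1.1 p.1.2 * ‖x p.1.1 - x p.1.2‖ ^ 2 * |⟪x i - x j, x p.1.1 - x p.1.2⟫| / D := by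
    have hdiff : x i - x j = (x i - x p.1.2) - (x j - x p.1.2) := by abel
    rw [hy, hy, ← sub_div, ← mul_sub, ← inner_sub_left, ← hdiff, abs_div, abs_of_pos hDpos,
      abs_mul, abs_of_nonneg (mul_nonneg (hdem _ _ p.2) (sq_nonneg _))]
  simp only [habs, ← Finset.sum_div]
  constructor
  · refine div_le_div_of_nonneg_right (Finset.sum_le_sum fun p _ => ?_) hDpos.le
    rw [mul_assoc, ← sq_abs ⟪x i - x j, x p.1.1 - x p.1.2⟫, sq |_|]
    refine mul_le_mul_of_nonneg_left (mul_le_mul_of_nonneg_right ?_ (abs_nonneg _)) (hdem _ _ p.2)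
    rw [real_inner_comm]
    exact abs_inner_sub_sub_le_norm_sub_sq x htri _ _ _ _
  · rw [div_le_iff₀ hDpos, mul_comm, hD, Finset.sum_mul]
    exact Finset.sum_le_sum fun p _ => mul_le_mul_of_nonneg_left
      (abs_inner_sub_sub_le_norm_sub_sq x htri _ _ _ _)
      (mul_nonneg (hdem _ _ p.2) (sq_nonneg _))
end

section
/- Let x_1, …, x_n be vectors in a real inner product space satisfying the ℓ₂² triangle inequalities, and let c_{ij} ≥ 0 and d_{ij} ≥ 0 for 1 ≤ i < j ≤ n be cost and demand weights with D = Σ_{k<l} d_{kl} ‖x_k − x_l‖² > 0 and Q = Σ_{i<j} Σ_{k<l} d_{ij} d_{kl} ⟨x_i − x_j, x_k − x_l⟩² > 0. Define y_i ∈ ℝ^{N} (coordinates indexed by pairs k < l) by y_i(k, l) = d_{kl} ‖x_k − x_l‖² ⟨x_i − x_l, x_k − x_l⟩ / D. Then Σ_{i<j} d_{ij} ‖y_i − y_j‖₁ > 0 and (Σ_{i<j} c_{ij} ‖y_i − y_j‖₁) / (Σ_{i<j} d_{ij} ‖y_i − y_j‖₁) ≤ ((Σ_{i<j} c_{ij}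 ‖x_i − x_j‖²) / D) · (D² / Q). -/
open RealInnerProductSpace

/-- Under the `ℓ₂²` triangle inequalities, `|⟪x i - x j, x k - x l⟫| ≤ ‖x i - x j‖ ^ 2`. -/
theorem abs_inner_sub_sub_le_of_sq_triangle {E ι : Type*} [NormedAddCommGroup E]
    [InnerProductSpace ℝ E] {x : ι → E}
    (htri : ∀ i j k : ι, ‖x i - x k‖ ^ 2 ≤ ‖x i - x j‖ ^ 2 + ‖x j - x k‖ ^ 2) (i j k l : ι) :
    |⟪x i - x j, x k - x l⟫| ≤ ‖x i - x j‖ ^ 2 := by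
  have hinner : ∀ a b m : ι, 0 ≤ ⟪x a - x m, x b - x m⟫ := fun a b m => by
    have h := norm_sub_sq_real (x a - x m) (x b - x m)
    rw [sub_sub_sub_cancel_right] at h
    have ht := htri a m b
    rw [norm_sub_rev (x m)] at ht
    linarith
  have key : ∀ k l : ι, ⟪x i - x j, x k - x l⟫ ≤ ‖x i - x j‖ ^ 2 := fun k l => by
    have h₁ := hinner j k i
    have h₂ := hinner i l j
    rw [← real_inner_self_eq_norm_sq]
    simp only [inner_sub_left, inner_sub_right] at *
    linarith
  refine abs_le.2 ⟨?_, key k l⟩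
  have h := key l k
  rw [← neg_sub (x k), inner_neg_right] at h
  linarith

/-- The ℓ₁ ratio of the embedding `y` is at most `Φ(SDP) · D² / Q`, where
`Φ(SDP) = (∑ c_{ij} ‖x i − x j‖²) / D` and
`Q = ∑_{i<j} ∑_{k<l} d_{ij} d_{kl} ⟪x i − x j, x k − x l⟫²`. -/
theorem stmt_7 {E : Type*} [NormedAddCommGroup E] [InnerProductSpace ℝ E]
    {n : ℕ} (x : Fin n → E)
    (htri : ∀ i j k : Fin n, ‖x i - x k‖ ^ 2 ≤ ‖x i - x j‖ ^ 2 + ‖x j - x k‖ ^ 2)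
    (c dem : Fin n → Fin n → ℝ)
    (hc : ∀ i j : Fin n, i < j → 0 ≤ c i j) (hdem : ∀ i j : Fin n, i < j → 0 ≤ dem i j)
    (D : ℝ) (hD : D = ∑ p : Pairs n, dem p.1.1 p.1.2 * ‖x p.1.1 - x p.1.2‖ ^ 2)
    (hDpos : 0 < D)
    (Q : ℝ)
    (hQ : Q = ∑ p : Pairs n, ∑ q : Pairs n,
      dem p.1.1 p.1.2 * dem q.1.1 q.1.2 * ⟪x p.1.1 - x p.1.2, x q.1.1 - x q.1.2⟫ ^ 2)
    (hQpos : 0 < Q)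
    (y : Fin n → Pairs n → ℝ)
    (hy : ∀ (i : Fin n) (p : Pairs n),
      y i p = dem p.1.1 p.1.2 * ‖x p.1.1 - x p.1.2‖ ^ 2 * ⟪x i - x p.1.2, x p.1.1 - x p.1.2⟫ / D) :
    0 < ∑ p : Pairs n, dem p.1.1 p.1.2 * ∑ q : Pairs n, |y p.1.1 q - y p.1.2 q| ∧
      (∑ p : Pairs n, c p.1.1 p.1.2 * ∑ q : Pairs n, |y p.1.1 q - y p.1.2 q|) /
          (∑ p : Pairs n, dem p.1.1 p.1.2 * ∑ q : Pairs n, |y p.1.1 q - y p.1.2 q|) ≤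
        ((∑ p : Pairs n, c p.1.1 p.1.2 * ‖x p.1.1 - x p.1.2‖ ^ 2) / D) * (D ^ 2 / Q) := by
  have hy_sub : ∀ (i j : Fin n) (q : Pairs n), |y i q - y j q| =
      dem q.1.1 q.1.2 * ‖x q.1.1 - x q.1.2‖ ^ 2 * |⟪x i - x j, x q.1.1 - x q.1.2⟫| / D := by
    intro i j q
    have hw : 0 ≤ dem q.1.1 q.1.2 * ‖x q.1.1 - x q.1.2‖ ^ 2 :=
      mul_nonneg (hdem _ _ q.2) (sq_nonneg _)
    rw [hy, hy, ← sub_div, ← mul_sub, ← inner_sub_left, sub_sub_sub_cancel_right, abs_div,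
      abs_mul, abs_of_nonneg hw, abs_of_pos hDpos]
  have hupper : ∀ i j : Fin n, ∑ q : Pairs n, |y i q - y j q| ≤ ‖x i - x j‖ ^ 2 := by
    intro i j
    simp only [hy_sub]
    rw [← Finset.sum_div, div_le_iff₀ hDpos, hD, Finset.mul_sum]
    refine Finset.sum_le_sum fun q _ => ?_
    rw [mul_comm (‖x i - x j‖ ^ 2)]
    exact mul_le_mul_of_nonneg_left (abs_inner_sub_sub_le_of_sq_triangle htri _ _ _ _)
      (mul_nonneg (hdem _ _ q.2) (sq_nonneg _))
  have hlower : Q / D ≤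
      ∑ p : Pairs n, dem p.1.1 p.1.2 * ∑ q : Pairs n, |y p.1.1 q - y p.1.2 q| := by
    simp only [hy_sub]
    rw [hQ, Finset.sum_div]
    refine Finset.sum_le_sum fun p _ => ?_
    rw [Finset.sum_div, Finset.mul_sum]
    refine Finset.sum_le_sum fun q _ => ?_
    rw [mul_div_assoc', mul_assoc, mul_assoc]
    refine div_le_div_of_nonneg_right (mul_le_mul_of_nonneg_left
      (mul_le_mul_of_nonneg_left ?_ (hdem _ _ q.2)) (hdem _ _ p.2)) hDpos.le
    rw [← sq_abs ⟪x p.1.1 - x p.1.2, x q.1.1 - x q.1.2⟫, sq |_|]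
    refine mul_le_mul_of_nonneg_right ?_ (abs_nonneg _)
    rw [real_inner_comm]
    exact abs_inner_sub_sub_le_of_sq_triangle htri _ _ _ _
  have hQD : 0 < Q / D := div_pos hQpos hDpos
  refine ⟨hQD.trans_le hlower, ?_⟩
  have hcost : ∑ p : Pairs n, c p.1.1 p.1.2 * ∑ q : Pairs n, |y p.1.1 q - y p.1.2 q| ≤
      ∑ p : Pairs n, c p.1.1 p.1.2 * ‖x p.1.1 - x p.1.2‖ ^ 2 :=
    Finset.sum_le_sum fun p _ => mul_le_mul_of_nonneg_left (hupper _ _) (hc _ _ p.2)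
  have hcost_nonneg : 0 ≤ ∑ p : Pairs n, c p.1.1 p.1.2 * ‖x p.1.1 - x p.1.2‖ ^ 2 :=
    Finset.sum_nonneg fun p _ => mul_nonneg (hc _ _ p.2) (sq_nonneg _)
  refine (div_le_div₀ hcost_nonneg hcost hQD hlower).trans_eq ?_
  field_simp
end

section
/- Let c_{ij}, d_{ij} ≥ 0 (1 ≤ i < j ≤ n) be cost and demand weights, let x_1, …, x_n ∈ ℝ^m satisfy the ℓ₂² triangle inequalities with D = Σ_{i<j} d_{ij} ‖x_i − x_j‖² > 0, and set Φ(SDP) = (Σ_{i<j} c_{ij} ‖x_i − x_j‖²) / D. Let σ_1 ≥ … ≥ σ_N ≥ 0 be the descending eigenvalues of the Gram matrix of {√(d_{ij})(x_i − x_j)}_{i<j}. Suppose λ > 0 is such that there exists a linear subspace Z ⊆ ℝ^n with dim Z ≤ r and Σ_{i<j} c_{ij} (w_i − w_j)² ≥ λ · Σ_{i<j} d_{ij} (w_i − w_j)² for every w ∈ ℝ^n orthogonal to Z (i.e., λ ≤ λ_{r+1}, the (r+1)-st generalized eigenvalue of the Laplacians of the cost and demand graphs). Then Σ_{t=r+1}^{N}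 σ_t ≤ (Φ(SDP)/λ) · Σ_{t=1}^{N} σ_t. -/
open RealInnerProductSpace Finset

/-- Removing from a nonnegative decreasing sequence fractions `q t ∈ [0, 1]` of total mass at most
`r` leaves at least the sum of the terms of index at least `r`. -/
theorem tail_sum_le_sum_mul_one_sub {N r : ℕ} (σ q : Fin N → ℝ) (hσ : Antitone σ)
    (hσ0 : ∀ t, 0 ≤ σ t) (hq0 : ∀ t, 0 ≤ q t) (hq1 : ∀ t, q t ≤ 1) (hq : ∑ t, q t ≤ r) :
    ∑ t ∈ univ.filter (fun t : Fin N => r ≤ (t : ℕ)), σ t ≤ ∑ t, σ t * (1 - q t) := by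
  rcases le_or_gt N r with hN | hN
  · rw [Finset.filter_false_of_mem (fun t _ => by have := t.2; omega), Finset.sum_empty]
    exact Finset.sum_nonneg fun t _ => mul_nonneg (hσ0 t) (sub_nonneg.2 (hq1 t))
  · set s := σ ⟨r, hN⟩
    have hcard : ∑ t : Fin N, (if r ≤ (t : ℕ) then (0 : ℝ) else 1) = r := by
      rw [Fin.sum_univ_eq_sum_range (fun t => if r ≤ t then (0 : ℝ) else 1) N,
        ← Finset.sum_range_add_sum_Ico _ hN.le,
        Finset.sum_congr rfl (g := fun _ => (1 : ℝ))
          (fun t ht => if_neg (not_le.2 (Finset.mem_range.1 ht))),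
        Finset.sum_congr (s₁ := Finset.Ico r N) rfl (g := fun _ => (0 : ℝ))
          (fun t ht => if_pos (Finset.mem_Ico.1 ht).1)]
      simp
    have key : ∀ t : Fin N, s * ((if r ≤ (t : ℕ) then (0 : ℝ) else 1) - q t) ≤
        σ t * (1 - q t) - (if r ≤ (t : ℕ) then σ t else 0) := by
      intro t
      split_ifs with h
      · have : σ t ≤ s := hσ (show (⟨r, hN⟩ : Fin N) ≤ t from h)
        nlinarith [hq0 t]
      · have : s ≤ σ t := hσ (show t ≤ (⟨r, hN⟩ : Fin N) from (not_le.1 h).le)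
        nlinarith [hq1 t]
    have hsum := Finset.sum_le_sum fun t (_ : t ∈ univ) => key t
    rw [← Finset.mul_sum, Finset.sum_sub_distrib, Finset.sum_sub_distrib, hcard,
      ← Finset.sum_filter] at hsum
    have : 0 ≤ s * (r - ∑ t, q t) := mul_nonneg (hσ0 _) (sub_nonneg.2 hq)
    linarith

/-- Approximating vectors by elements of an `r`-dimensional subspace costs at least the tail of the
spectrum of their covariance form. -/
theorem tail_sum_le_sum_norm_sub_sq {E κ : Type*} [NormedAddCommGroup E] [InnerProductSpace ℝ E]
    [FiniteDimensional ℝ E] [Fintype κ] {N r : ℕ} (σ : Fin N → ℝ) (hσ : Antitone σ)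
    (b : OrthonormalBasis (Fin N) ℝ E) (a u : κ → E)
    (hab : ∀ v : E, ∑ k, ⟪a k, v⟫ ^ 2 = ∑ t, σ t * ⟪b t, v⟫ ^ 2)
    (U : Submodule ℝ E) (hU : Module.finrank ℝ U ≤ r) (hu : ∀ k, u k ∈ U) :
    ∑ t ∈ univ.filter (fun t : Fin N => r ≤ (t : ℕ)), σ t ≤ ∑ k, ‖a k - u k‖ ^ 2 := by
  have hσa : ∀ t, σ t = ∑ k, ⟪a k, b t⟫ ^ 2 := by
    intro t
    rw [hab, Finset.sum_eq_single t]
    · simp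
    · intro s _ hs
      simp [b.inner_eq_ite, hs]
    · simp
  have hσ0 : ∀ t, 0 ≤ σ t := fun t => by
    rw [hσa]
    positivity
  let f := stdOrthonormalBasis ℝ U
  have hf : ∀ v : E, ‖U.starProjection v‖ ^ 2 = ∑ j, ⟪v, (f j : E)⟫ ^ 2 := by
    intro v
    rw [Submodule.starProjection_apply, Submodule.norm_coe,
      ← f.sum_sq_norm_inner_right (U.orthogonalProjectionOnto v)]
    refine Finset.sum_congr rfl fun j _ => ?_
    rw [Real.norm_eq_abs, sq_abs, real_inner_comm]
    congr 1
    exact Submodule.inner_orthogonalProjectionOnto_eq_of_mem_right (f j) v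
  have hPyth : ∀ v : E, ‖v‖ ^ 2 = ‖U.starProjection v‖ ^ 2 + ‖v - U.starProjection v‖ ^ 2 := by
    intro v
    have := U.norm_sq_eq_add_norm_sq_starProjection v
    rwa [Submodule.starProjection_orthogonal_val] at this
  have hq : ∑ t, ‖U.starProjection (b t)‖ ^ 2 ≤ r := by
    simp_rw [hf]
    rw [Finset.sum_comm]
    have : ∀ j, ∑ t, ⟪b t, (f j : E)⟫ ^ 2 = 1 := by
      intro j
      have h := b.sum_sq_norm_inner_right (f j : E)
      simp only [Real.norm_eq_abs, sq_abs] at h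
      rw [h, Submodule.norm_coe, f.orthonormal.1 j, one_pow]
    simp_rw [this]
    simpa using hU
  have htotal : ∑ k, ‖a k‖ ^ 2 = ∑ t, σ t := by
    simp_rw [hσa]
    rw [Finset.sum_comm]
    refine Finset.sum_congr rfl fun k _ => ?_
    rw [← b.sum_sq_norm_inner_left (a k)]
    simp
  have hproj : ∑ k, ‖U.starProjection (a k)‖ ^ 2 =
      ∑ t, σ t * ‖U.starProjection (b t)‖ ^ 2 := by
    simp_rw [hf, Finset.mul_sum]
    rw [Finset.sum_comm, Finset.sum_comm (s := (univ : Finset (Fin N)))]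
    exact Finset.sum_congr rfl fun j _ => hab _
  have hmin : ∀ k, ‖a k - U.starProjection (a k)‖ ^ 2 ≤ ‖a k - u k‖ ^ 2 := by
    intro k
    gcongr
    rw [Submodule.starProjection_minimal]
    exact ciInf_le ⟨0, by rintro _ ⟨y, rfl⟩; positivity⟩ (⟨u k, hu k⟩ : U)
  calc _ ≤ ∑ t, σ t * (1 - ‖U.starProjection (b t)‖ ^ 2) := by
        refine tail_sum_le_sum_mul_one_sub σ _ hσ hσ0 (fun t => by positivity) (fun t => ?_) hq
        have := hPyth (b t)
        rw [b.orthonormal.1 t] at this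
        nlinarith [sq_nonneg ‖b t - U.starProjection (b t)‖]
    _ = ∑ k, ‖a k - U.starProjection (a k)‖ ^ 2 := by
        simp_rw [mul_sub, mul_one]
        rw [Finset.sum_sub_distrib, ← hproj, ← htotal, ← Finset.sum_sub_distrib]
        exact Finset.sum_congr rfl fun k _ => by linarith [hPyth (a k)]
    _ ≤ _ := Finset.sum_le_sum fun k _ => hmin k

/-- There is a linear map into `Zᗮ` that does not increase the seminorm `‖L ·‖` and that differs
from the identity by a map of rank at most `dim Z`. -/
theorem exists_linearMap_orthogonal_norm_le {V E : Type*}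
    [NormedAddCommGroup V] [InnerProductSpace ℝ V] [FiniteDimensional ℝ V]
    [NormedAddCommGroup E] [InnerProductSpace ℝ E] [FiniteDimensional ℝ E]
    (L : V →ₗ[ℝ] E) (Z : Submodule ℝ V) :
    ∃ T : V →ₗ[ℝ] V, (∀ y, T y ∈ Zᗮ) ∧ (∀ y, ‖L (T y)‖ ≤ ‖L y‖) ∧
      Module.finrank ℝ (LinearMap.range (LinearMap.id - T)) ≤ Module.finrank ℝ Z := by
  let M : Zᗮ →ₗ[ℝ] E := L ∘ₗ Zᗮ.subtype
  obtain ⟨S, hS⟩ := M.rangeRestrict.exists_rightInverse_of_surjective M.range_rangeRestrict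
  let P : E →ₗ[ℝ] LinearMap.range M := (LinearMap.range M).orthogonalProjectionOnto.toLinearMap
  let R : V →ₗ[ℝ] V := Zᗮ.subtype ∘ₗ S ∘ₗ P ∘ₗ L
  let pZ : V →ₗ[ℝ] V := Z.starProjection.toLinearMap
  have hRmem : ∀ y, R y ∈ Zᗮ := fun y => (S (P (L y))).2
  have hpZ : ∀ y, y - pZ y ∈ Zᗮ := fun y => Z.sub_starProjection_mem_orthogonal y
  have hLR : ∀ y, L (R y) = (LinearMap.range M).starProjection (L y) := fun y =>
    congrArg Subtype.val (LinearMap.congr_fun hS (P (L y)))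
  refine ⟨LinearMap.id - pZ + R ∘ₗ pZ, fun y => Zᗮ.add_mem (hpZ y) (hRmem _), fun y => ?_, ?_⟩
  · have h1 : (LinearMap.range M).starProjection (L (y - pZ y)) = L (y - pZ y) :=
      Submodule.starProjection_eq_self_iff.2 ⟨⟨_, hpZ y⟩, rfl⟩
    have h2 : L ((LinearMap.id - pZ + R ∘ₗ pZ : V →ₗ[ℝ] V) y) = (LinearMap.range M).starProjection (L y) := by
      change L (y - pZ y + R (pZ y)) = _
      rw [map_add, hLR, ← h1, ← map_add, ← map_add, sub_add_cancel]
    rw [h2]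
    exact Submodule.norm_starProjection_apply_le _ _
  · have hle : LinearMap.range (LinearMap.id - (LinearMap.id - pZ + R ∘ₗ pZ) : V →ₗ[ℝ] V) ≤
        Z.map (LinearMap.id - R) := by
      rintro _ ⟨y, rfl⟩
      refine ⟨pZ y, Z.starProjection_apply_mem y, ?_⟩
      simp only [LinearMap.sub_apply, LinearMap.add_apply, LinearMap.id_apply,
        LinearMap.comp_apply]
      abel
    exact (Submodule.finrank_mono hle).trans (Submodule.finrank_map_le _ _)

/-- The quadratic form of a Gram matrix in terms of its eigenvalues. -/
theorem sum_inner_sq_eq_sum_eigenvalues_mul {ι κ : Type*} [Fintype ι] [DecidableEq ι] [Fintype κ]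
    {G : Matrix ι ι ℝ} (hG : G.IsHermitian) (a : κ → EuclideanSpace ℝ ι)
    (h : ∀ p q, G p q = ∑ k, a k p * a k q) (v : EuclideanSpace ℝ ι) :
    ∑ k, ⟪a k, v⟫ ^ 2 = ∑ p, hG.eigenvalues p * ⟪hG.eigenvectorBasis p, v⟫ ^ 2 := by
  have hGv : ∀ v w : EuclideanSpace ℝ ι,
      ⟪WithLp.toLp 2 (G.mulVec v), w⟫ = ∑ k, ⟪a k, v⟫ * ⟪a k, w⟫ := by
    intro v w
    simp only [PiLp.inner_apply, RCLike.inner_apply, conj_trivial, Matrix.mulVec, dotProduct, h,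
      Finset.sum_mul, Finset.mul_sum]
    rw [Finset.sum_congr rfl fun p _ => Finset.sum_comm, Finset.sum_comm]
    exact Finset.sum_congr rfl fun k _ => Finset.sum_congr rfl fun p _ =>
      Finset.sum_congr rfl fun q _ => by ring
  have hb : ∀ p, ⟪hG.eigenvectorBasis p, WithLp.toLp 2 (G.mulVec v)⟫ =
      hG.eigenvalues p * ⟪hG.eigenvectorBasis p, v⟫ := by
    intro p
    have h1 := hGv v (hG.eigenvectorBasis p)
    have h2 := hGv (hG.eigenvectorBasis p) v
    rw [hG.mulVec_eigenvectorBasis, WithLp.toLp_smul, WithLp.toLp_ofLp, real_inner_smul_left] at h2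
    rw [real_inner_comm, h1, h2]
    exact Finset.sum_congr rfl fun k _ => mul_comm _ _
  have h3 := hGv v v
  rw [← hG.eigenvectorBasis.sum_inner_mul_inner] at h3
  simp_rw [sq, ← h3]
  refine Finset.sum_congr rfl fun p _ => ?_
  rw [real_inner_comm, hb]
  ring

/-- The linear map sending `y` to the weighted differences `√(w i j) (y i - y j)`. -/
noncomputable def weightedDiff {n : ℕ} (w : Fin n → Fin n → ℝ) :
    EuclideanSpace ℝ (Fin n) →ₗ[ℝ] EuclideanSpace ℝ (Pairs n) where
  toFun y := WithLp.toLp 2 fun p => Real.sqrt (w p.1.1 p.1.2) * (y p.1.1 - y p.1.2)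
  map_add' y z := by
    ext p
    simp only [PiLp.add_apply]
    ring
  map_smul' s y := by
    ext p
    simp only [PiLp.smul_apply, smul_eq_mul, RingHom.id_apply]
    ring

theorem norm_weightedDiff_sq {n : ℕ} {w : Fin n → Fin n → ℝ}
    (hw : ∀ i j : Fin n, i < j → 0 ≤ w i j) (y : EuclideanSpace ℝ (Fin n)) :
    ‖weightedDiff w y‖ ^ 2 = ∑ p : Pairs n, w p.1.1 p.1.2 * (y p.1.1 - y p.1.2) ^ 2 := by
  rw [EuclideanSpace.norm_sq_eq]
  refine Finset.sum_congr rfl fun p _ => ?_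
  simp only [weightedDiff, LinearMap.coe_mk, AddHom.coe_mk, Real.norm_eq_abs, sq_abs, mul_pow,
    Real.sq_sqrt (hw _ _ p.2)]

/-- The Laplacian form of vectors is the sum of the Laplacian forms of their coordinates. -/
theorem sum_norm_weightedDiff_sq {m n : ℕ} {w : Fin n → Fin n → ℝ}
    (hw : ∀ i j : Fin n, i < j → 0 ≤ w i j) (x : Fin n → EuclideanSpace ℝ (Fin m)) :
    ∑ k, ‖weightedDiff w (WithLp.toLp 2 fun i => x i k)‖ ^ 2 =
      ∑ p : Pairs n, w p.1.1 p.1.2 * ‖x p.1.1 - x p.1.2‖ ^ 2 := by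
  simp_rw [norm_weightedDiff_sq hw, EuclideanSpace.norm_sq_eq, Finset.mul_sum]
  rw [Finset.sum_comm]
  simp

/-- Proposition 6 (Guruswami–Sinop): if `λ ≤ λ_{r+1}`, the `(r+1)`-st generalized eigenvalue of
the Laplacians of the cost and demand graphs (expressed via its variational characterization by
a subspace `Z` of dimension at most `r`), then the tail of the spectrum of the Gram matrix of
`{√(d_{ij})(x i − x j)}_{i<j}` satisfies `∑_{t>r} σ_t ≤ (Φ(SDP)/λ) ∑_t σ_t`. -/
theorem stmt_9 {m n N r : ℕ} (x : Fin n → EuclideanSpace ℝ (Fin m))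
    (htri : ∀ i j k : Fin n, ‖x i - x k‖ ^ 2 ≤ ‖x i - x j‖ ^ 2 + ‖x j - x k‖ ^ 2)
    (c dem : Fin n → Fin n → ℝ)
    (hc : ∀ i j : Fin n, i < j → 0 ≤ c i j) (hdem : ∀ i j : Fin n, i < j → 0 ≤ dem i j)
    (D : ℝ) (hD : D = ∑ p : Pairs n, dem p.1.1 p.1.2 * ‖x p.1.1 - x p.1.2‖ ^ 2)
    (hDpos : 0 < D)
    (Φ : ℝ) (hΦ : Φ = (∑ p : Pairs n, c p.1.1 p.1.2 * ‖x p.1.1 - x p.1.2‖ ^ 2) / D)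
    (G : Matrix (Pairs n) (Pairs n) ℝ)
    (hGdef : ∀ p q : Pairs n, G p q =
      ⟪Real.sqrt (dem p.1.1 p.1.2) • (x p.1.1 - x p.1.2),
        Real.sqrt (dem q.1.1 q.1.2) • (x q.1.1 - x q.1.2)⟫)
    (hG : G.IsHermitian)
    (σ : Fin N → ℝ) (e : Fin N ≃ Pairs n)
    (hσ : ∀ t, σ t = hG.eigenvalues (e t))
    (hdesc : Antitone σ)
    (lam : ℝ) (hlam : 0 < lam)
    (Z : Submodule ℝ (EuclideanSpace ℝ (Fin n))) (hZ : Module.finrank ℝ Z ≤ r)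
    (hquad : ∀ w : EuclideanSpace ℝ (Fin n), w ∈ Zᗮ →
      lam * ∑ p : Pairs n, dem p.1.1 p.1.2 * (w p.1.1 - w p.1.2) ^ 2 ≤
        ∑ p : Pairs n, c p.1.1 p.1.2 * (w p.1.1 - w p.1.2) ^ 2) :
    ∑ t ∈ univ.filter (fun t : Fin N => r ≤ (t : ℕ)), σ t ≤ (Φ / lam) * ∑ t, σ t := by
  obtain ⟨T, hTmem, hTle, hTrank⟩ := exists_linearMap_orthogonal_norm_le (weightedDiff c) Z
  let y : Fin m → EuclideanSpace ℝ (Fin n) := fun k => WithLp.toLp 2 fun i => x i k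
  let a : Fin m → EuclideanSpace ℝ (Pairs n) := fun k => weightedDiff dem (y k)
  let b := hG.eigenvectorBasis.reindex e.symm
  have hGa : ∀ p q, G p q = ∑ k, a k p * a k q := by
    intro p q
    rw [hGdef, PiLp.inner_apply]
    refine Finset.sum_congr rfl fun k _ => ?_
    simp [a, y, weightedDiff, mul_comm]
  have hab : ∀ v, ∑ k, ⟪a k, v⟫ ^ 2 = ∑ t, σ t * ⟪b t, v⟫ ^ 2 := by
    intro v
    rw [sum_inner_sq_eq_sum_eigenvalues_mul hG a hGa, ← e.sum_comp]
    simp [hσ, b]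
  have hU : Module.finrank ℝ
      ((LinearMap.range (LinearMap.id - T)).map (weightedDiff dem)) ≤ r :=
    (Submodule.finrank_map_le _ _).trans (hTrank.trans hZ)
  have htail := tail_sum_le_sum_norm_sub_sq σ hdesc b a
    (fun k => weightedDiff dem (y k - T (y k))) hab _ hU
    (fun k => ⟨y k - T (y k), ⟨y k, rfl⟩, rfl⟩)
  have htotal : ∑ t, σ t = D := by
    have htr := hG.trace_eq_sum_eigenvalues
    rw [← e.sum_comp] at htr
    simp only [RCLike.ofReal_real_eq_id, id_eq, ← hσ] at htr
    rw [← htr, hD, ← sum_norm_weightedDiff_sq hdem, Matrix.trace]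
    simp_rw [Matrix.diag_apply, hGa, EuclideanSpace.norm_sq_eq]
    rw [Finset.sum_comm]
    simp [a, y, sq]
  have hbound : ∀ k, lam * ‖a k - weightedDiff dem (y k - T (y k))‖ ^ 2 ≤
      ‖weightedDiff c (y k)‖ ^ 2 := by
    intro k
    have hsub : a k - weightedDiff dem (y k - T (y k)) = weightedDiff dem (T (y k)) := by
      simp [a]
    have h := hquad (T (y k)) (hTmem _)
    rw [← norm_weightedDiff_sq hdem, ← norm_weightedDiff_sq hc] at h
    rw [hsub]
    exact h.trans (by gcongr; exact hTle _)
  have hsum := Finset.sum_le_sum fun k (_ : k ∈ univ) => hbound k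
  rw [← Finset.mul_sum, sum_norm_weightedDiff_sq hc] at hsum
  rw [htotal, hΦ, div_div, div_mul_eq_mul_div, mul_comm D lam, mul_div_mul_right _ _ hDpos.ne',
    le_div_iff₀ hlam, mul_comm]
  exact (mul_le_mul_of_nonneg_left htail hlam.le).trans hsum
end

section
/- Let c_{ij}, d_{ij} ≥ 0 (1 ≤ i < j ≤ n) be cost and demand weights, let x_1, …, x_n ∈ ℝ^m satisfy the ℓ₂² triangle inequalities with D = Σ_{i<j} d_{ij} ‖x_i − x_j‖² > 0, and set Φ(SDP) = (Σ_{i<j} c_{ij} ‖x_i − x_j‖²) / D. Let 0 < δ < 1 and suppose there exists λ ≥ Φ(SDP)/(1 − δ) and a linear subspace Z ⊆ ℝ^n with dim Z ≤ r (r ≥ 1) such that Σ_{i<j} c_{ij} (w_i − w_j)² ≥ λ · Σ_{i<j} d_{ij} (w_i − w_j)² for every w ∈ ℝ^n orthogonal to Z. Then there exists a subset S ⊆ [n] with Σ_{i<j} d_{ij} |1_S(i) − 1_S(j)| > 0 and Φ(S) ≤ (r/δ²) · Φ(SDP). -/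
open RealInnerProductSpace

open MeasureTheory in
/-- The length of a segment is the measure of the set of thresholds that separate its ends. -/
lemma abs_sub_eq_integral_threshold (s t : ℝ) :
    Integrable (fun θ : ℝ => |(if s ≤ θ then (1 : ℝ) else 0) - (if t ≤ θ then (1 : ℝ) else 0)|) ∧
      ∫ θ : ℝ, |(if s ≤ θ then (1 : ℝ) else 0) - (if t ≤ θ then (1 : ℝ) else 0)| = |s - t| := by
  have h : (fun θ : ℝ => |(if s ≤ θ then (1 : ℝ) else 0) - (if t ≤ θ then (1 : ℝ) else 0)|) =
      (Set.Ico (min s t) (max s t)).indicator 1 := by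
    funext θ
    simp only [Set.indicator_apply, Set.mem_Ico, min_le_iff, lt_max_iff, Pi.one_apply]
    by_cases hs : s ≤ θ <;> by_cases ht : t ≤ θ <;> simp [hs, ht, not_lt.mpr, not_le.mp]
  rw [h]
  refine ⟨(integrable_indicator_iff measurableSet_Ico).mpr ?_, ?_⟩
  · exact integrableOn_const (by simp)
  · rw [integral_indicator_one measurableSet_Ico, Measure.real, Real.volume_Ico,
      ENNReal.toReal_ofReal (by simp), max_sub_min_eq_abs, abs_sub_comm]

open MeasureTheory in
/-- A line metric can be rounded to a threshold cut. -/
lemma exists_cut_of_line {n : ℕ} (c d : Pairs n → ℝ) (hc : ∀ p, 0 ≤ c p) (hd : ∀ p, 0 ≤ d p)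
    (t : Fin n → ℝ) (K : ℝ) (hpos : 0 < ∑ p, d p * |t p.1.1 - t p.1.2|)
    (hle : ∑ p, c p * |t p.1.1 - t p.1.2| ≤ K * ∑ p, d p * |t p.1.1 - t p.1.2|) :
    ∃ S : Finset (Fin n),
      0 < ∑ p, d p * |(if p.1.1 ∈ S then (1 : ℝ) else 0) - (if p.1.2 ∈ S then (1 : ℝ) else 0)| ∧
        (∑ p, c p * |(if p.1.1 ∈ S then (1 : ℝ) else 0) - (if p.1.2 ∈ S then (1 : ℝ) else 0)|) /
          (∑ p, d p * |(if p.1.1 ∈ S then (1 : ℝ) else 0) - (if p.1.2 ∈ S then (1 : ℝ) else 0)|)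
          ≤ K := by
  by_contra! hno
  set cut : (Pairs n → ℝ) → ℝ → ℝ := fun a θ => ∑ p, a p *
    |(if t p.1.1 ≤ θ then (1 : ℝ) else 0) - (if t p.1.2 ≤ θ then (1 : ℝ) else 0)| with hcut
  have hint : ∀ a, Integrable (cut a) := fun a =>
    integrable_finsetSum _ fun p _ => (abs_sub_eq_integral_threshold _ _).1.const_mul _
  have hval : ∀ a, ∫ θ, cut a θ = ∑ p, a p * |t p.1.1 - t p.1.2| := fun a => by
    rw [hcut, integral_finsetSum _
      fun p _ => (abs_sub_eq_integral_threshold _ _).1.const_mul _]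
    refine Finset.sum_congr rfl fun p _ => ?_
    rw [integral_const_mul, (abs_sub_eq_integral_threshold _ _).2]
  have hnn : ∀ a, (∀ p, 0 ≤ a p) → ∀ θ, 0 ≤ cut a θ := fun a ha θ =>
    Finset.sum_nonneg fun p _ => mul_nonneg (ha p) (abs_nonneg _)
  have hstrict : ∀ θ, 0 < cut d θ → K * cut d θ < cut c θ := fun θ hθ => by
    have h := hno (Finset.univ.filter fun i => t i ≤ θ)
    simp only [Finset.mem_filter, Finset.mem_univ, true_and] at h
    exact (lt_div_iff₀ hθ).mp (h hθ)
  have hdiff : ∀ θ, 0 ≤ cut c θ - K * cut d θ := fun θ => by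
    rcases (hnn d hd θ).eq_or_lt with h | h
    · rw [← h]; simpa using hnn c hc θ
    · exact (sub_pos.mpr (hstrict θ h)).le
  have hI : Integrable (fun θ => cut c θ - K * cut d θ) := (hint c).sub ((hint d).const_mul K)
  have hzero : ∫ θ, (cut c θ - K * cut d θ) = 0 := by
    refine le_antisymm ?_ (integral_nonneg hdiff)
    rw [integral_sub (hint c) ((hint d).const_mul K), integral_const_mul, hval, hval]
    linarith
  have hae := (integral_eq_zero_iff_of_nonneg hdiff hI).mp hzero
  have hdae : cut d =ᵐ[volume] 0 := by
    filter_upwards [hae] with θ hθ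
    by_contra hne
    have := hstrict θ (lt_of_le_of_ne (hnn d hd θ) (Ne.symm hne))
    simp only [Pi.zero_apply] at hθ
    linarith
  have := hval d
  rw [integral_congr_ae hdae] at this
  simp only [Pi.zero_apply, integral_zero] at this
  linarith

section
universe u
variable {E : Type u} [NormedAddCommGroup E] [InnerProductSpace ℝ E]

/-- Under the squared triangle inequalities, differences pair to at most a squared distance. -/
lemma abs_inner_sub_le_of_sq_triangle {ι : Type*} (x : ι → E)
    (htri : ∀ i j k, ‖x i - x k‖ ^ 2 ≤ ‖x i - x j‖ ^ 2 + ‖x j - x k‖ ^ 2) (i j k l : ι) :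
    |⟪x k - x l, x i - x j⟫| ≤ ‖x i - x j‖ ^ 2 := by
  have e : 2 * ⟪x k - x l, x i - x j⟫ =
      ‖x k - x j‖ ^ 2 + ‖x l - x i‖ ^ 2 - ‖x k - x i‖ ^ 2 - ‖x l - x j‖ ^ 2 := by
    simp only [norm_sub_sq_real, inner_sub_left, inner_sub_right]
    ring
  have h1 := htri k i j
  have h2 := htri l j i
  have h3 := htri k j i
  have h4 := htri l i j
  rw [norm_sub_rev (x j) (x i)] at h2 h3
  rw [abs_le]
  constructor <;> linarith

/-- The diagonal of a Gram operator is bounded by its Frobenius norm. -/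
lemma sum_sq_diagonal_le {ι κ : Type*} [Fintype ι] [Fintype κ] (b : OrthonormalBasis κ ℝ E)
    (d : ι → ℝ) (y : ι → E) :
    ∑ a, (∑ p, d p * ⟪b a, y p⟫ ^ 2) ^ 2 ≤ ∑ p, d p * ∑ q, d q * ⟪y p, y q⟫ ^ 2 := by
  have hG : ∑ p, d p * ∑ q, d q * ⟪y p, y q⟫ ^ 2 =
      ∑ a, ∑ a', (∑ p, d p * (⟪b a, y p⟫ * ⟪b a', y p⟫)) ^ 2 := by
    have hin : ∀ p q, ⟪y p, y q⟫ = ∑ a, ⟪b a, y p⟫ * ⟪b a, y q⟫ := fun p q => by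
      rw [← b.sum_inner_mul_inner]
      exact Finset.sum_congr rfl fun a _ => by rw [real_inner_comm]
    simp_rw [hin, sq, Finset.sum_mul_sum, Finset.mul_sum]
    calc _ = ∑ p, ∑ a, ∑ q, ∑ a', d p * (d q * (⟪b a, y p⟫ * ⟪b a, y q⟫ *
          (⟪b a', y p⟫ * ⟪b a', y q⟫))) := Finset.sum_congr rfl fun p _ => Finset.sum_comm
      _ = ∑ a, ∑ p, ∑ a', ∑ q, d p * (d q * (⟪b a, y p⟫ * ⟪b a, y q⟫ *
          (⟪b a', y p⟫ * ⟪b a', y q⟫))) := by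
        rw [Finset.sum_comm]
        exact Finset.sum_congr rfl fun a _ => Finset.sum_congr rfl fun p _ => Finset.sum_comm
      _ = _ := by
        refine Finset.sum_congr rfl fun a _ => ?_
        rw [Finset.sum_comm]
        refine Finset.sum_congr rfl fun a' _ => Finset.sum_congr rfl fun p _ =>
          Finset.sum_congr rfl fun q _ => ?_
        ring
  rw [hG]
  refine Finset.sum_le_sum fun a _ => ?_
  have := Finset.single_le_sum (f := fun a' => (∑ p, d p * (⟪b a, y p⟫ * ⟪b a', y p⟫)) ^ 2)
    (fun a' _ => sq_nonneg _) (Finset.mem_univ a)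
  simpa only [sq] using this

/-- A subspace of codimension at most `r` contains all but `r` vectors of some orthonormal
basis. -/
lemma exists_orthonormalBasis_mem_of_codim_le [FiniteDimensional ℝ E] (U : Submodule ℝ E) (r : ℕ)
    (hU : Module.finrank ℝ E ≤ r + Module.finrank ℝ U) :
    ∃ (κ : Type u) (_ : Fintype κ) (b : OrthonormalBasis κ ℝ E) (s : Finset κ),
      s.card ≤ r ∧ ∀ a, a ∉ s → b a ∈ U := by
  classical
  let e := stdOrthonormalBasis ℝ U
  let v : Finset E := Finset.univ.image fun k => (e k : E)
  have hinj : Function.Injective fun k => (e k : E) :=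
    Subtype.val_injective.comp e.orthonormal.linearIndependent.injective
  have hv : Orthonormal ℝ ((↑) : ↥(v : Set E) → E) := by
    have h : Orthonormal ℝ fun k => (e k : E) :=
      e.orthonormal.comp_linearIsometry U.subtypeₗᵢ
    have := h.toSubtypeRange
    have hvr : (v : Set E) = Set.range fun k => (e k : E) := by simp [v]
    rw [hvr]
    exact this
  obtain ⟨u, b, hvu, hb⟩ := hv.exists_orthonormalBasis_extension
  have hvu' : v ⊆ u := by exact_mod_cast hvu
  refine ⟨u, inferInstance, b, Finset.univ.filter fun a => (a : E) ∉ v, ?_, ?_⟩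
  · have hcu : u.card = Module.finrank ℝ E := by
      rw [Module.finrank_eq_card_basis b.toBasis, Fintype.card_coe]
    have hcv : v.card = Module.finrank ℝ U := by
      rw [Finset.card_image_of_injective _ hinj]; simp
    have hcs : (Finset.univ.filter fun a : u => (a : E) ∉ v).card ≤ (u \ v).card := by
      refine Finset.card_le_card_of_injOn (fun a => (a : E)) ?_ Subtype.val_injective.injOn
      intro a ha
      simpa using ha
    rw [Finset.card_sdiff_of_subset hvu'] at hcs
    omega
  · intro a ha
    have hav : (a : E) ∈ v := by simpa using ha
    obtain ⟨k, -, hk⟩ := Finset.mem_image.mp hav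
    rw [hb, ← hk]
    exact (e k).2

/-- If a subspace of codimension at most `r` carries at most a `1 - δ` fraction of the energy of a
weighted family, then the family correlates with one of its members. -/
lemma exists_le_sum_abs_inner {ι : Type*} [Fintype ι] {κ : Type*} [Fintype κ]
    (b : OrthonormalBasis κ ℝ E) (s : Finset κ) (r : ℕ) (hr : 1 ≤ r) (hs : s.card ≤ r)
    (d : ι → ℝ) (hd : ∀ p, 0 ≤ d p) (y : ι → E) (D δ : ℝ)
    (hD : D = ∑ p, d p * ‖y p‖ ^ 2) (hDpos : 0 < D) (hδ : 0 < δ)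
    (hy : ∀ p q, |⟪y p, y q⟫| ≤ ‖y p‖ ^ 2)
    (hen : δ * D ≤ ∑ a ∈ s, ∑ p, d p * ⟪b a, y p⟫ ^ 2) :
    ∃ p, δ ^ 2 * D / r ≤ ∑ q, d q * |⟪y p, y q⟫| := by
  have hr0 : (0 : ℝ) < r := by exact_mod_cast hr
  have hsr : (s.card : ℝ) ≤ r := by exact_mod_cast hs
  have hcs : (δ * D) ^ 2 ≤ r * ∑ p, d p * ∑ q, d q * ⟪y p, y q⟫ ^ 2 := by
    calc (δ * D) ^ 2 ≤ (∑ a ∈ s, ∑ p, d p * ⟪b a, y p⟫ ^ 2) ^ 2 := by gcongr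
      _ ≤ s.card * ∑ a ∈ s, (∑ p, d p * ⟪b a, y p⟫ ^ 2) ^ 2 := sq_sum_le_card_mul_sum_sq
      _ ≤ r * ∑ a, (∑ p, d p * ⟪b a, y p⟫ ^ 2) ^ 2 := by
        refine mul_le_mul hsr ?_ (Finset.sum_nonneg fun a _ => sq_nonneg _) hr0.le
        exact Finset.sum_le_univ_sum_of_nonneg (s := s)
          (f := fun a => (∑ p, d p * ⟪b a, y p⟫ ^ 2) ^ 2) fun a => sq_nonneg _
      _ ≤ _ := by gcongr; exact sum_sq_diagonal_le b d y
  have hsq : ∀ p q, ⟪y p, y q⟫ ^ 2 ≤ ‖y p‖ ^ 2 * |⟪y p, y q⟫| := fun p q => by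
    rw [← sq_abs, sq]
    exact mul_le_mul_of_nonneg_right (hy p q) (abs_nonneg _)
  by_contra! hno
  have hterm : ∀ p, d p * ∑ q, d q * ⟪y p, y q⟫ ^ 2 ≤
      d p * ‖y p‖ ^ 2 * ∑ q, d q * |⟪y p, y q⟫| := fun p => by
    rw [mul_assoc, Finset.mul_sum (a := ‖y p‖ ^ 2)]
    refine mul_le_mul_of_nonneg_left (Finset.sum_le_sum fun q _ => ?_) (hd p)
    calc d q * ⟪y p, y q⟫ ^ 2 ≤ d q * (‖y p‖ ^ 2 * |⟪y p, y q⟫|) :=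
          mul_le_mul_of_nonneg_left (hsq p q) (hd q)
      _ = _ := by ring
  have hlt : ∑ p, d p * ‖y p‖ ^ 2 * ∑ q, d q * |⟪y p, y q⟫| <
      ∑ p, d p * ‖y p‖ ^ 2 * (δ ^ 2 * D / r) := by
    have hnn : ∀ p, 0 ≤ d p * ‖y p‖ ^ 2 := fun p => mul_nonneg (hd p) (sq_nonneg _)
    obtain ⟨p, -, hp⟩ := Finset.exists_lt_of_sum_lt (s := Finset.univ) (f := fun _ : ι => (0 : ℝ))
      (g := fun p => d p * ‖y p‖ ^ 2) (by simpa [← hD] using hDpos)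
    exact Finset.sum_lt_sum (fun p _ => mul_le_mul_of_nonneg_left (hno p).le (hnn p))
      ⟨p, Finset.mem_univ p, mul_lt_mul_of_pos_left (hno p) hp⟩
  rw [← Finset.sum_mul, ← hD] at hlt
  have hfin := (Finset.sum_le_sum fun p (_ : p ∈ Finset.univ) => hterm p).trans_lt hlt
  have := hcs.trans_lt (mul_lt_mul_of_pos_left hfin hr0)
  have e : (r : ℝ) * (D * (δ ^ 2 * D / r)) = (δ * D) ^ 2 := by field_simp
  linarith

/-- The coordinate functionals of `x` that are orthogonal to `Z` form a subspace of codimension at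
most `finrank Z`. -/
lemma exists_subspace_inner_mem_orthogonal [FiniteDimensional ℝ E] {n : ℕ} (x : Fin n → E)
    (Z : Submodule ℝ (EuclideanSpace ℝ (Fin n))) :
    ∃ U : Submodule ℝ E, Module.finrank ℝ E ≤ Module.finrank ℝ Z + Module.finrank ℝ U ∧
      ∀ u ∈ U, (WithLp.toLp 2 fun i => ⟪u, x i⟫) ∈ Zᗮ := by
  let T : E →ₗ[ℝ] EuclideanSpace ℝ (Fin n) :=
    { toFun := fun u => WithLp.toLp 2 fun i => ⟪u, x i⟫
      map_add' := fun u v => by ext i; simp [inner_add_left]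
      map_smul' := fun a u => by ext i; simp [inner_smul_left] }
  let L : E →ₗ[ℝ] Z := Z.orthogonalProjectionOnto.toLinearMap ∘ₗ T
  refine ⟨LinearMap.ker L, ?_, fun u hu => ?_⟩
  · have h1 := L.finrank_range_add_finrank_ker
    have h2 := Submodule.finrank_le (LinearMap.range L)
    omega
  · exact Submodule.orthogonalProjectionOnto_eq_zero_iff.mp hu

end

/-- Corollary: if `λ_{r+1} ≥ Φ(SDP)/(1 − δ)` (witnessed by a subspace `Z` of dimension at most
`r` and `λ ≥ Φ(SDP)/(1 − δ)`), then there is a cut `S` with `Φ(S) ≤ (r/δ²) Φ(SDP)`. -/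
theorem stmt_11 {m n r : ℕ} (x : Fin n → EuclideanSpace ℝ (Fin m))
    (htri : ∀ i j k : Fin n, ‖x i - x k‖ ^ 2 ≤ ‖x i - x j‖ ^ 2 + ‖x j - x k‖ ^ 2)
    (c dem : Fin n → Fin n → ℝ)
    (hc : ∀ i j : Fin n, i < j → 0 ≤ c i j) (hdem : ∀ i j : Fin n, i < j → 0 ≤ dem i j)
    (D : ℝ) (hD : D = ∑ p : Pairs n, dem p.1.1 p.1.2 * ‖x p.1.1 - x p.1.2‖ ^ 2)
    (hDpos : 0 < D)
    (Φ : ℝ) (hΦ : Φ = (∑ p : Pairs n, c p.1.1 p.1.2 * ‖x p.1.1 - x p.1.2‖ ^ 2) / D)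
    (δ : ℝ) (hδ0 : 0 < δ) (hδ1 : δ < 1)
    (lam : ℝ) (hlam : Φ / (1 - δ) ≤ lam) (hr : 1 ≤ r)
    (Z : Submodule ℝ (EuclideanSpace ℝ (Fin n))) (hZ : Module.finrank ℝ Z ≤ r)
    (hquad : ∀ w : EuclideanSpace ℝ (Fin n), w ∈ Zᗮ →
      lam * ∑ p : Pairs n, dem p.1.1 p.1.2 * (w p.1.1 - w p.1.2) ^ 2 ≤
        ∑ p : Pairs n, c p.1.1 p.1.2 * (w p.1.1 - w p.1.2) ^ 2) :
    ∃ S : Finset (Fin n),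
      0 < ∑ p : Pairs n, dem p.1.1 p.1.2 *
          |(if p.1.1 ∈ S then (1 : ℝ) else 0) - (if p.1.2 ∈ S then (1 : ℝ) else 0)| ∧
        (∑ p : Pairs n, c p.1.1 p.1.2 *
            |(if p.1.1 ∈ S then (1 : ℝ) else 0) - (if p.1.2 ∈ S then (1 : ℝ) else 0)|) /
          (∑ p : Pairs n, dem p.1.1 p.1.2 *
            |(if p.1.1 ∈ S then (1 : ℝ) else 0) - (if p.1.2 ∈ S then (1 : ℝ) else 0)|) ≤
          ((r : ℝ) / δ ^ 2) * Φ := by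
  classical
  set y : Pairs n → EuclideanSpace ℝ (Fin m) := fun p => x p.1.1 - x p.1.2 with hy
  set C : Pairs n → ℝ := fun p => c p.1.1 p.1.2 with hCdef
  set d : Pairs n → ℝ := fun p => dem p.1.1 p.1.2 with hddef
  have hC : ∀ p, 0 ≤ C p := fun p => hc _ _ p.2
  have hd : ∀ p, 0 ≤ d p := fun p => hdem _ _ p.2
  change D = ∑ p, d p * ‖y p‖ ^ 2 at hD
  have hcost : ∑ p, C p * ‖y p‖ ^ 2 = Φ * D := by
    rw [hΦ, div_mul_cancel₀ _ hDpos.ne']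
  have hyy : ∀ p q, |⟪y p, y q⟫| ≤ ‖y q‖ ^ 2 := fun p q =>
    abs_inner_sub_le_of_sq_triangle x htri _ _ _ _
  have hyy' : ∀ p q, |⟪y p, y q⟫| ≤ ‖y p‖ ^ 2 := fun p q => by
    rw [real_inner_comm]; exact hyy q p
  have hΦ0 : 0 ≤ Φ := by
    have : 0 ≤ Φ * D := hcost ▸ Finset.sum_nonneg fun p _ => mul_nonneg (hC p) (sq_nonneg _)
    exact nonneg_of_mul_nonneg_left this hDpos
  have hr0 : (0 : ℝ) < r := by exact_mod_cast hr
  have hround : ∀ p, 0 < ∑ q, d q * |⟪y p, y q⟫| →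
      Φ * D ≤ r / δ ^ 2 * Φ * ∑ q, d q * |⟪y p, y q⟫| → _ := fun p h1 h2 =>
    exists_cut_of_line C d hC hd (fun i => ⟪y p, x i⟫) (r / δ ^ 2 * Φ)
      (by simpa only [← inner_sub_right] using h1) (by
        simp only [← inner_sub_right]
        refine le_trans ?_ h2
        rw [← hcost]
        exact Finset.sum_le_sum fun q _ => mul_le_mul_of_nonneg_left (hyy p q) (hC q))
  rcases hΦ0.eq_or_lt with hΦz | hΦpos
  · obtain ⟨p, -, hp⟩ := Finset.exists_lt_of_sum_lt (s := Finset.univ)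
      (f := fun _ : Pairs n => (0 : ℝ)) (g := fun p => d p * ‖y p‖ ^ 2)
      (by simpa [← hD] using hDpos)
    refine hround p (hp.trans_le ?_) (by simp [← hΦz])
    refine le_trans (le_of_eq ?_) (Finset.single_le_sum (f := fun q => d q * |⟪y p, y q⟫|)
      (fun q _ => mul_nonneg (hd q) (abs_nonneg _)) (Finset.mem_univ p))
    simp
  · obtain ⟨U, hUdim, hU⟩ := exists_subspace_inner_mem_orthogonal x Z
    obtain ⟨κ, _, b, s, hs, hbU⟩ := exists_orthonormalBasis_mem_of_codim_le U r (by omega)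
    have hparseval : ∀ a : Pairs n → ℝ,
        ∑ k, ∑ p, a p * ⟪b k, y p⟫ ^ 2 = ∑ p, a p * ‖y p‖ ^ 2 := fun a => by
      rw [Finset.sum_comm]
      refine Finset.sum_congr rfl fun p _ => ?_
      rw [← Finset.mul_sum, ← b.sum_sq_inner_right (y p)]
    have hlampos : 0 < lam := (div_pos hΦpos (sub_pos.mpr hδ1)).trans_le hlam
    have htail : lam * ∑ k ∈ Finset.univ \ s, ∑ p, d p * ⟪b k, y p⟫ ^ 2 ≤ Φ * D := by
      calc lam * ∑ k ∈ Finset.univ \ s, ∑ p, d p * ⟪b k, y p⟫ ^ 2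
          ≤ ∑ k ∈ Finset.univ \ s, ∑ p, C p * ⟪b k, y p⟫ ^ 2 := by
            rw [Finset.mul_sum]
            refine Finset.sum_le_sum fun k hk => ?_
            have h := hquad _ (hU _ (hbU k (Finset.mem_sdiff.mp hk).2))
            simpa only [← inner_sub_right] using h
        _ ≤ ∑ k, ∑ p, C p * ⟪b k, y p⟫ ^ 2 :=
            Finset.sum_le_univ_sum_of_nonneg fun k => Finset.sum_nonneg fun p _ =>
              mul_nonneg (hC p) (sq_nonneg _)
        _ = Φ * D := by rw [hparseval, hcost]
    have hen : δ * D ≤ ∑ k ∈ s, ∑ p, d p * ⟪b k, y p⟫ ^ 2 := by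
      have hsplit := Finset.sum_sdiff (Finset.subset_univ s)
        (f := fun k => ∑ p, d p * ⟪b k, y p⟫ ^ 2)
      rw [hparseval, ← hD] at hsplit
      have h1 : Φ ≤ lam * (1 - δ) := (div_le_iff₀ (sub_pos.mpr hδ1)).mp hlam
      have h2 : ∑ k ∈ Finset.univ \ s, ∑ p, d p * ⟪b k, y p⟫ ^ 2 ≤ (1 - δ) * D := by
        refine le_of_mul_le_mul_left (htail.trans ?_) hlampos
        rw [← mul_assoc]
        exact mul_le_mul_of_nonneg_right h1 hDpos.le
      linarith
    obtain ⟨p, hp⟩ := exists_le_sum_abs_inner b s r hr hs d hd y D δ hD hDpos hδ0 hyy' hen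
    have hpos : 0 < δ ^ 2 * D / r := by positivity
    refine hround p (hpos.trans_le hp) ?_
    calc Φ * D = r / δ ^ 2 * Φ * (δ ^ 2 * D / r) := by field_simp
      _ ≤ _ := by gcongr
end

section
/- Let c_{ij}, d_{ij} ≥ 0 (1 ≤ i < j ≤ n) be cost and demand weights, and let p : [n] → ℝ be any real-valued embedding with Σ_{i<j} d_{ij} |p_i − p_j| > 0. Then there exists a threshold index t ∈ [n] such that the sweep cut S_t = {i ∈ [n] : p_i ≤ p_t} satisfies Σ_{i<j} d_{ij} |1_{S_t}(i) − 1_{S_t}(j)| > 0 and (Σ_{i<j} c_{ij} |1_{S_t}(i) − 1_{S_t}(j)|) / (Σ_{i<j} d_{ij} |1_{S_t}(i) − 1_{S_t}(j)|) ≤ (Σ_{i<j} c_{ij} |p_i − p_j|) / (Σ_{i<j} d_{ij} |p_i − p_j|). -/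
/-- Some nonnegative atomic measure on a finite set of reals has cumulative distribution function
`a ↦ a - b` on that set. -/
theorem exists_gap_weights (T : Finset ℝ) :
    ∃ (w : ℝ → ℝ) (b : ℝ), (∀ s, 0 ≤ w s) ∧
      ∀ a ∈ T, a = b + ∑ s ∈ T, if s < a then w s else 0 := by
  induction T using Finset.induction_on_max with
  | empty => exact ⟨0, 0, fun _ => le_rfl, by simp⟩
  | insert m T hm ih =>
    obtain ⟨w, b, hw, h⟩ := ih
    have hmT : m ∉ T := fun hmem => lt_irrefl _ (hm m hmem)
    rcases T.eq_empty_or_nonempty with rfl | hT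
    · exact ⟨0, m, fun _ => le_rfl, by simp⟩
    set M := T.max' hT with hM
    have hMT : M ∈ T := T.max'_mem hT
    have hle : ∀ a ∈ T, a ≤ M := fun a ha => T.le_max' a ha
    have hMm : M < m := hm M hMT
    refine ⟨Function.update w M (m - M), b, fun s => ?_, fun a ha => ?_⟩
    · rcases eq_or_ne s M with rfl | hs
      · simpa using hMm.le
      · simpa [hs] using hw s
    · rw [Finset.sum_insert hmT]
      rcases Finset.mem_insert.1 ha with rfl | haT
      · have hsum : ∑ s ∈ T, (if s < a then Function.update w M (a - M) s else 0) =
            ∑ s ∈ T, ((if s < M then w s else 0) + if s = M then a - M else 0) := by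
          refine Finset.sum_congr rfl fun s hs => ?_
          rw [if_pos (hm s hs)]
          rcases eq_or_ne s M with rfl | hsM
          · simp
          · simp [hsM, lt_of_le_of_ne (hle s hs) hsM]
        rw [hsum, Finset.sum_add_distrib, Finset.sum_ite_eq' T M, if_pos hMT]
        have := h M hMT
        simp only [lt_irrefl, if_false]
        linarith
      · rw [if_neg (hm a haT).not_gt, zero_add]
        refine (h a haT).trans (congrArg _ (Finset.sum_congr rfl fun s _ => ?_))
        split_ifs with hsa
        · rw [Function.update_of_ne (hsa.trans_le (hle a haT)).ne]
        · rfl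

/-- The line metric on a finite set of reals is a nonnegative combination of threshold cuts. -/
theorem exists_cut_weights (T : Finset ℝ) :
    ∃ w : ℝ → ℝ, (∀ s, 0 ≤ w s) ∧ ∀ x ∈ T, ∀ y ∈ T,
      |x - y| = ∑ s ∈ T, w s * |(if x ≤ s then (1 : ℝ) else 0) - (if y ≤ s then (1 : ℝ) else 0)| := by
  obtain ⟨w, b, hw, h⟩ := exists_gap_weights T
  have key : ∀ x ∈ T, ∀ y ∈ T, x ≤ y → |x - y| =
      ∑ s ∈ T, w s * |(if x ≤ s then (1 : ℝ) else 0) - (if y ≤ s then (1 : ℝ) else 0)| := by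
    intro x hx y hy hxy
    have hdiff : y - x =
        ∑ s ∈ T, ((if s < y then w s else 0) - if s < x then w s else 0) := by
      rw [Finset.sum_sub_distrib]
      linarith [h x hx, h y hy]
    rw [abs_sub_comm, abs_of_nonneg (sub_nonneg.2 hxy), hdiff]
    refine Finset.sum_congr rfl fun s _ => ?_
    rcases lt_or_ge s x with hsx | hsx
    · simp [hsx, hsx.trans_le hxy, hsx.not_ge, (hsx.trans_le hxy).not_ge]
    · rcases lt_or_ge s y with hsy | hsy
      · simp [hsx, hsx.not_gt, hsy, hsy.not_ge]
      · simp [hsx, hsx.not_gt, hsy, hsy.not_gt]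
  refine ⟨w, hw, fun x hx y hy => ?_⟩
  rcases le_total x y with hxy | hxy
  · exact key x hx y hy hxy
  · rw [abs_sub_comm, key y hy x hx hxy]
    exact Finset.sum_congr rfl fun s _ => by rw [abs_sub_comm]

/-- Mediant inequality: some ratio is at most the ratio of the weighted sums. -/
theorem exists_div_le_sum_div_sum {ι : Type*} (T : Finset ι) (w C D : ι → ℝ)
    (hw : ∀ s, 0 ≤ w s) (hC : ∀ s, 0 ≤ C s) (hD : ∀ s, 0 ≤ D s)
    (hpos : 0 < ∑ s ∈ T, w s * D s) :
    ∃ s ∈ T, 0 < D s ∧ C s / D s ≤ (∑ s ∈ T, w s * C s) / ∑ s ∈ T, w s * D s := by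
  set r := (∑ s ∈ T, w s * C s) / ∑ s ∈ T, w s * D s with hr
  by_contra! hcon
  have hlt : ∀ s ∈ T, 0 < D s → r * D s < C s := fun s hs hDs =>
    (lt_div_iff₀ hDs).1 (hcon s hs hDs)
  obtain ⟨s, hs, hsw⟩ := Finset.exists_lt_of_sum_lt
    (f := fun _ => (0 : ℝ)) (by simpa using hpos)
  have hDs : 0 < D s := pos_of_mul_pos_right hsw (hw s)
  have hws : 0 < w s := pos_of_mul_pos_left hsw (hD s)
  have hsum : ∑ s ∈ T, w s * (r * D s) < ∑ s ∈ T, w s * C s := by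
    refine Finset.sum_lt_sum (fun i hi => mul_le_mul_of_nonneg_left ?_ (hw i))
      ⟨s, hs, mul_lt_mul_of_pos_left (hlt s hs hDs) hws⟩
    rcases (hD i).eq_or_lt with h0 | h0
    · simpa [← h0] using hC i
    · exact (hlt i hi h0).le
  simp only [mul_left_comm _ r, ← Finset.mul_sum] at hsum
  rw [hr, div_mul_cancel₀ _ hpos.ne'] at hsum
  exact lt_irrefl _ hsum

/-- Threshold-rounding (sweep cut) lemma: for any line embedding `p : [n] → ℝ` with positive
demand ℓ₁-length, some sweep cut `S_t = {i : p i ≤ p t}` has sparsity at most the ℓ₁ ratio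
`(∑ c_{ij} |p i − p j|) / (∑ d_{ij} |p i − p j|)` of the embedding. -/
theorem stmt_13 {n : ℕ} (c dem : Fin n → Fin n → ℝ)
    (hc : ∀ i j : Fin n, i < j → 0 ≤ c i j) (hdem : ∀ i j : Fin n, i < j → 0 ≤ dem i j)
    (p : Fin n → ℝ)
    (hpos : 0 < ∑ q : Pairs n, dem q.1.1 q.1.2 * |p q.1.1 - p q.1.2|) :
    ∃ t : Fin n,
      0 < ∑ q : Pairs n, dem q.1.1 q.1.2 *
          |(if p q.1.1 ≤ p t then (1 : ℝ) else 0) - (if p q.1.2 ≤ p t then (1 : ℝ) else 0)| ∧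
        (∑ q : Pairs n, c q.1.1 q.1.2 *
            |(if p q.1.1 ≤ p t then (1 : ℝ) else 0) - (if p q.1.2 ≤ p t then (1 : ℝ) else 0)|) /
          (∑ q : Pairs n, dem q.1.1 q.1.2 *
            |(if p q.1.1 ≤ p t then (1 : ℝ) else 0) - (if p q.1.2 ≤ p t then (1 : ℝ) else 0)|) ≤
          (∑ q : Pairs n, c q.1.1 q.1.2 * |p q.1.1 - p q.1.2|) /
            (∑ q : Pairs n, dem q.1.1 q.1.2 * |p q.1.1 - p q.1.2|) := by
  obtain ⟨w, hw, hcut⟩ := exists_cut_weights (Finset.univ.image p)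
  have hmem : ∀ i, p i ∈ Finset.univ.image p := fun i =>
    Finset.mem_image_of_mem p (Finset.mem_univ i)
  have hdecomp : ∀ e : Fin n → Fin n → ℝ,
      ∑ q : Pairs n, e q.1.1 q.1.2 * |p q.1.1 - p q.1.2| =
        ∑ s ∈ Finset.univ.image p, w s * ∑ q : Pairs n, e q.1.1 q.1.2 *
          |(if p q.1.1 ≤ s then (1 : ℝ) else 0) - (if p q.1.2 ≤ s then (1 : ℝ) else 0)| := by
    intro e
    simp only [Finset.mul_sum]
    rw [Finset.sum_comm]
    refine Finset.sum_congr rfl fun q _ => ?_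
    rw [hcut _ (hmem _) _ (hmem _), Finset.mul_sum]
    exact Finset.sum_congr rfl fun s _ => mul_left_comm _ _ _
  have hnonneg : ∀ e : Fin n → Fin n → ℝ, (∀ i j : Fin n, i < j → 0 ≤ e i j) → ∀ s : ℝ,
      0 ≤ ∑ q : Pairs n, e q.1.1 q.1.2 *
        |(if p q.1.1 ≤ s then (1 : ℝ) else 0) - (if p q.1.2 ≤ s then (1 : ℝ) else 0)| :=
    fun e he s => Finset.sum_nonneg fun q _ => mul_nonneg (he _ _ q.2) (abs_nonneg _)
  rw [hdecomp dem] at hpos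
  obtain ⟨s, hs, hDs, hle⟩ := exists_div_le_sum_div_sum _ w _ _ hw (hnonneg c hc)
    (hnonneg dem hdem) hpos
  obtain ⟨t, -, rfl⟩ := Finset.mem_image.1 hs
  rw [hdecomp c, hdecomp dem]
  exact ⟨t, hDs, hle⟩
end
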